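/- Assume additionally that βf₂ < f₁ < f₃ and α > 1/2. Let J be the 6×6 Jacobian matrix of F at the equilibrium q. Then every real eigenvalue of J (every real root of the characteristic polynomial of J) is strictly negative. -/

import Mathlib

/-- The vector field of the viral evolution model on the symmetric 3-node
cross-immunoreactivity network (node 1 → node 2 ← node 3), in the variables
`(x₁, x₂, x₃, r₁, r₂, r₃) = (v 0, v 1, v 2, v 3, v 4, v 5)`. -/
noncomputable def F (p c b f₁ f₂ f₃ α β : ℝ) (v : Fin 6 → ℝ) : Fin 6 → ℝ :=
  ![f₁ * v 0 - p * v 0 * (v 3 + β * v 4),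
    f₂ * v 1 - p * v 1 * v 4,
    f₃ * v 2 - p * v 2 * (β * v 4 + v 5),
    c * v 0 * v 3 / (v 3 + α * v 4) - b * v 3,
    c * (α * v 0 * v 4 / (v 3 + α * v 4) + v 1 + α * v 2 * v 4 / (α * v 4 + v 5)) - b * v 4,
    c * v 2 * v 5 / (α * v 4 + v 5) - b * v 5]

/-- The local-immunodeficiency equilibrium `q`. -/
noncomputable def q (p c b f₁ f₃ α β : ℝ) : Fin 6 → ℝ :=
  ![b / c * (f₁ / (p * β)) * (1 - α), 0,
    b / c * (α * (f₁ / (p * β)) + (f₃ - f₁) / p),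
    0, f₁ / (p * β), (f₃ - f₁) / p]

/-- The Jacobian matrix (matrix of partial derivatives) of a vector field at a point. -/
noncomputable def jacobianMat {ι : Type*} [Fintype ι] [DecidableEq ι]
    (G : (ι → ℝ) → ι → ℝ) (y : ι → ℝ) : Matrix ι ι ℝ :=
  Matrix.of fun i j => fderiv ℝ (fun v => G v i) y (Pi.single j 1)

theorem jac_mulVec {ι : Type*} [Fintype ι] [DecidableEq ι]
    (G : (ι → ℝ) → ι → ℝ) (y w : ι → ℝ) (i : ι) :
    (jacobianMat G y).mulVec w i = fderiv ℝ (fun v => G v i) y w := by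
  have hw : w = ∑ j, w j • (Pi.single j (1 : ℝ) : ι → ℝ) := by
    ext k
    simp [Finset.sum_apply, Pi.single_apply]
  conv_rhs => rw [hw]
  rw [map_sum]
  simp [jacobianMat, Matrix.mulVec, dotProduct, mul_comm]

theorem fd_frac (y : Fin 6 → ℝ) (i j k l : Fin 6) (α : ℝ)
    (h : y k + α * y l ≠ 0) :
    HasFDerivAt (fun v : Fin 6 → ℝ => v i * v j / (v k + α * v l))
      ((1 / (y k + α * y l)) • (y i • ContinuousLinearMap.proj (R := ℝ) (φ := fun _ : Fin 6 => ℝ) j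
        + y j • ContinuousLinearMap.proj (R := ℝ) (φ := fun _ : Fin 6 => ℝ) i)
        - (y i * y j / (y k + α * y l) ^ 2) •
          (ContinuousLinearMap.proj (R := ℝ) (φ := fun _ : Fin 6 => ℝ) k
            + α • ContinuousLinearMap.proj (R := ℝ) (φ := fun _ : Fin 6 => ℝ) l)) y := by
  have hp := fun m : Fin 6 => hasFDerivAt_apply (𝕜 := ℝ) (F' := fun _ : Fin 6 => ℝ) m y
  have h0 : HasFDerivAt (fun v : Fin 6 → ℝ => v k + α * v l) _ y := (hp k).add ((hp l).const_mul α)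
  have h2 := (hasDerivAt_inv h).comp_hasFDerivAt y h0
  have h1 := ((hp i).mul (hp j)).mul h2
  refine HasFDerivAt.congr_fderiv (f := fun v : Fin 6 → ℝ => v i * v j / (v k + α * v l)) h1 ?_
  ext u
  simp
  field_simp
  ring

theorem alg_core (b P R S α β lam z3 z4 : ℝ) (hb : 0 < b) (hP : 0 < P) (hR : 0 < R) (hS : 0 < S)
    (hα0 : 0 < α) (hα : α < 1) (hβ : 0 < β) (hl : 0 ≤ lam)
    (e1 : ((α * R + S) * lam ^ 2 + lam * b * (α * R + S - α * S) + β * P * R * (α * R + S)) * z3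
      + (lam * b * α * R + P * α * R * (α * R + S)) * z4 = 0)
    (e2 : (lam * b * α * S + P * S * β * (α * R + S)) * z3
      + ((α * R + S) * lam ^ 2 + lam * b * S + P * S * (α * R + S)) * z4 = 0) :
    z3 = 0 ∧ z4 = 0 := by
  have hT : 0 < α * R + S := by positivity
  obtain ⟨γ, hga⟩ : ∃ γ : ℝ, γ = 1 - α := ⟨_, rfl⟩
  have hγ : 0 < γ := by linarith
  generalize hTT : α * R + S = T at *
  have hA' : T - α * S = α * R + γ * S := by rw [← hTT, hga]; ring
  rw [hA'] at e1
  have hD : 0 < (T * lam ^ 2 + lam * b * (α * R + γ * S) + β * P * R * T)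
      * (T * lam ^ 2 + lam * b * S + P * S * T)
      - (lam * b * α * R + P * α * R * T) * (lam * b * α * S + P * S * β * T) := by
    have : (T * lam ^ 2 + lam * b * (α * R + γ * S) + β * P * R * T)
      * (T * lam ^ 2 + lam * b * S + P * S * T)
      - (lam * b * α * R + P * α * R * T) * (lam * b * α * S + P * S * β * T)
      = T ^ 2 * lam ^ 4 + T * lam ^ 3 * b * (α * R + γ * S + S)
        + lam ^ 2 * (b ^ 2 * S * (α * R * γ + γ * S) + T ^ 2 * P * (S + β * R))
        + lam * b * P * S * T * (α * R * γ + γ * S + γ * β * R)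
        + P ^ 2 * β * R * S * T ^ 2 * γ := by
      rw [hga]; ring
    rw [this]; positivity
  have h3 : ((T * lam ^ 2 + lam * b * (α * R + γ * S) + β * P * R * T)
      * (T * lam ^ 2 + lam * b * S + P * S * T)
      - (lam * b * α * R + P * α * R * T) * (lam * b * α * S + P * S * β * T)) * z3 = 0 := by
    linear_combination (T * lam ^ 2 + lam * b * S + P * S * T) * e1
      - (lam * b * α * R + P * α * R * T) * e2
  have hz3 : z3 = 0 := (mul_eq_zero.mp h3).resolve_left hD.ne'
  refine ⟨hz3, ?_⟩
  rw [hz3] at e2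
  have h4 : 0 < T * lam ^ 2 + lam * b * S + P * S * T := by positivity
  have h5 : (T * lam ^ 2 + lam * b * S + P * S * T) * z4 = 0 := by linarith
  exact (mul_eq_zero.mp h5).resolve_left h4.ne'

/-- Assuming additionally `βf₂ < f₁ < f₃` and `α > 1/2`, every real eigenvalue
(real root of the characteristic polynomial) of the Jacobian of `F` at the
equilibrium `q` is strictly negative. -/
theorem stmt4 (p c b f₁ f₂ f₃ α β : ℝ)
    (hp : 0 < p) (hc : 0 < c) (hb : 0 < b)
    (hf₁ : 0 < f₁) (hf₂ : 0 < f₂) (hf₃ : 0 < f₃)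
    (hβ : 0 < β) (hβα : β < α) (hα : α < 1) (h13 : f₁ < f₃)
    (hβf₂ : β * f₂ < f₁) (hα2 : 1 / 2 < α) :
    ∀ lam : ℝ,
      (Matrix.charpoly (jacobianMat (F p c b f₁ f₂ f₃ α β) (q p c b f₁ f₃ α β))).IsRoot lam →
        lam < 0 := by
  intro lam hroot
  by_contra! hl
  have hα0 : 0 < α := hβ.trans hβα
  rw [Polynomial.IsRoot, Matrix.eval_charpoly] at hroot
  obtain ⟨w, hw0, hw⟩ := Matrix.exists_mulVec_eq_zero_iff.mpr hroot
  apply hw0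
  have key : ∀ i, lam * w i =
      fderiv ℝ (fun v => F p c b f₁ f₂ f₃ α β v i) (q p c b f₁ f₃ α β) w := by
    intro i
    rw [← jac_mulVec]
    have := congrFun hw i
    rw [Matrix.sub_mulVec] at this
    simp [Matrix.scalar_apply, Matrix.mulVec_diagonal] at this
    linarith
  obtain ⟨R, hR⟩ : ∃ R, R = f₁ / (p * β) := ⟨_, rfl⟩
  obtain ⟨S, hS⟩ : ∃ S, S = (f₃ - f₁) / p := ⟨_, rfl⟩
  have hRp : 0 < R := by rw [hR]; positivity
  have hSp : 0 < S := by rw [hS]; exact div_pos (by linarith) hp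
  have hf1 : f₁ = p * β * R := by rw [hR]; field_simp
  have hf3 : f₃ = p * β * R + p * S := by rw [hR, hS]; field_simp; ring
  have hTp : 0 < α * R + S := by positivity
  generalize hy : q p c b f₁ f₃ α β = y at key
  unfold q at hy
  rw [← hR, ← hS] at hy
  have y0 : y 0 = b / c * R * (1 - α) := by rw [← hy]; rfl
  have y1 : y 1 = 0 := by rw [← hy]; rfl
  have y2 : y 2 = b / c * (α * R + S) := by rw [← hy]; rfl
  have y3 : y 3 = 0 := by rw [← hy]; rfl
  have y4 : y 4 = R := by rw [← hy]; rfl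
  have y5 : y 5 = S := by rw [← hy]; rfl
  have hd1 : y 3 + α * y 4 ≠ 0 := by rw [y3, y4]; positivity
  have hd2 : y 5 + α * y 4 ≠ 0 := by rw [y5, y4]; positivity
  have pr := fun m : Fin 6 => hasFDerivAt_apply (𝕜 := ℝ) (F' := fun _ : Fin 6 => ℝ) m y
  have k0 := key 0
  have k1 := key 1
  have k2 := key 2
  have k3 := key 3
  have k4 := key 4
  have k5 := key 5
  have g0 := ((pr 0).const_mul f₁).sub (((pr 0).const_mul p).mul ((pr 3).add ((pr 4).const_mul β)))
  have g1 := ((pr 1).const_mul f₂).sub (((pr 1).const_mul p).mul (pr 4))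
  have g2 := ((pr 2).const_mul f₃).sub (((pr 2).const_mul p).mul (((pr 4).const_mul β).add (pr 5)))
  have g3 := ((fd_frac y 0 3 3 4 α hd1).const_mul c).sub ((pr 3).const_mul b)
  have g4 := (((((fd_frac y 0 4 3 4 α hd1).const_mul α).add (pr 1)).add
    ((fd_frac y 2 4 5 4 α hd2).const_mul α)).const_mul c).sub ((pr 4).const_mul b)
  have g5 := ((fd_frac y 2 5 5 4 α hd2).const_mul c).sub ((pr 5).const_mul b)
  have m0 := g0.congr_of_eventuallyEq (f₁ := fun v => F p c b f₁ f₂ f₃ α β v 0)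
    (Filter.Eventually.of_forall fun v => by simp [F])
  have m1 := g1.congr_of_eventuallyEq (f₁ := fun v => F p c b f₁ f₂ f₃ α β v 1)
    (Filter.Eventually.of_forall fun v => by simp [F])
  have m2 := g2.congr_of_eventuallyEq (f₁ := fun v => F p c b f₁ f₂ f₃ α β v 2)
    (Filter.Eventually.of_forall fun v => by simp [F])
  have m3 := g3.congr_of_eventuallyEq (f₁ := fun v => F p c b f₁ f₂ f₃ α β v 3)
    (Filter.Eventually.of_forall fun v => by simp [F]; ring)
  have m4 := g4.congr_of_eventuallyEq (f₁ := fun v => F p c b f₁ f₂ f₃ α β v 4)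
    (Filter.Eventually.of_forall fun v => by simp [F]; rw [add_comm (α * v 4) (v 5)]; left; ring)
  have m5 := g5.congr_of_eventuallyEq (f₁ := fun v => F p c b f₁ f₂ f₃ α β v 5)
    (Filter.Eventually.of_forall fun v => by simp [F]; rw [add_comm (α * v 4) (v 5)]; ring)
  rw [m0.fderiv] at k0
  rw [m1.fderiv] at k1
  rw [m2.fderiv] at k2
  rw [m3.fderiv] at k3
  rw [m4.fderiv] at k4
  rw [m5.fderiv] at k5
  clear m0 m1 m2 m3 m4 m5 g0 g1 g2 g3 g4 g5 key hy hw hroot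
  simp [y0, y1, y2, y3, y4, y5] at k0 k1 k2 k3 k4 k5
  have hf2 : f₂ < p * R := by
    rw [hf1] at hβf₂
    by_contra! h
    nlinarith
  clear hR hS
  have w1 : w 1 = 0 := by
    have : (lam + (p * R - f₂)) * w 1 = 0 := by linear_combination k1
    exact (mul_eq_zero.mp this).resolve_left (by linarith)
  have w3 : w 3 = 0 := by
    have : (α * lam + b * (2 * α - 1)) * w 3 = 0 := by
      field_simp at k3
      linear_combination k3
    refine (mul_eq_zero.mp this).resolve_left ?_
    have : 0 < b * (2 * α - 1) := mul_pos hb (by linarith)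
    positivity
  simp [w1, w3] at k0 k2 k4 k5
  have hT' : S + α * R ≠ 0 := by positivity
  have q0 : c * (lam * w 0) = - (p * β * b * R * (1 - α)) * w 4 := by
    rw [k0, hf1]; field_simp; ring
  have q2 : c * (lam * w 2) = - (p * b * (α * R + S)) * (β * w 4 + w 5) := by
    rw [k2, hf3]; field_simp; ring
  have q4 : (α * R + S) * (lam * w 4) = c * (α * R + S) * w 0 + c * α * R * w 2
      + b * (α * S - (α * R + S)) * w 4 - b * α * R * w 5 := by
    rw [k4]; field_simp; ring
  have q5 : (α * R + S) * (lam * w 5) = c * S * w 2 - b * α * S * w 4 - b * S * w 5 := by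
    rw [k5]; field_simp; ring
  obtain ⟨w4, w5⟩ := alg_core b (b * p) R S α β lam (w 4) (w 5) hb (by positivity) hRp hSp hα0 hα hβ hl
    (by linear_combination lam * q4 + (α * R + S) * q0 + α * R * q2)
    (by linear_combination lam * q5 + S * q2)
  rw [w4, w5] at q4 q5
  have w2 : w 2 = 0 := by
    have : c * S * w 2 = 0 := by linarith
    exact (mul_eq_zero.mp this).resolve_left (by positivity)
  rw [w2] at q4
  have w0 : w 0 = 0 := by
    have : c * (α * R + S) * w 0 = 0 := by linarith
    exact (mul_eq_zero.mp this).resolve_left (by positivity)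
  ext i
  fin_cases i <;> simp [w0, w1, w2, w3, w4, w5]
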